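/- Let k be a field, A a smooth k-algebra, and j ≥ 1. Then Ω^j_{A⊗A} decomposes as an internal direct sum Ω^j_{A⊗A} = p₁^*(Ω^j_A) ⊕ J^j: every ω ∈ Ω^j_{A⊗A} can be written uniquely as ω = p₁^*(δ) + η with δ ∈ Ω^j_A and η ∈ J^j. -/

import Mathlib

set_option maxHeartbeats 1000000
set_option synthInstance.maxHeartbeats 400000

open TensorProduct

noncomputable section

variable (k : Type) [Field k]

/-- The element `d s` of the exterior algebra `⋀_S Ω¹_{S/k}` of Kähler differentials,
i.e. the universal derivation followed by the degree-one inclusion. -/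
def dE (S : Type) [CommRing S] [Algebra k S] (s : S) :
    ExteriorAlgebra S (KaehlerDifferential k S) :=
  ExteriorAlgebra.ι S (KaehlerDifferential.D k S s)

/-- `Ω^j_{S/k}`, realized as the degree-`j` component of the exterior algebra of
`Ω¹_{S/k}`, i.e. the `j`-th power of the image of `Ω¹` in the exterior algebra. -/
def OmegaPow (S : Type) [CommRing S] [Algebra k S] (j : ℕ) :
    Submodule S (ExteriorAlgebra S (KaehlerDifferential k S)) :=
  (LinearMap.range (ExteriorAlgebra.ι S :
    KaehlerDifferential k S →ₗ[S] ExteriorAlgebra S (KaehlerDifferential k S))) ^ j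

/-- `J^j`, the degree `j` part of the differential graded ideal of `Ω^•_{S/k}` generated
by an ideal `I ⊆ S`:  `J^0 = I` (inside `Ω^0 = S`), and
`J^j = I·Ω^j + dI ∧ Ω^{j-1}` for `j ≥ 1`. -/
def Jdeg (S : Type) [CommRing S] [Algebra k S] (I : Ideal S) :
    ℕ → Submodule S (ExteriorAlgebra S (KaehlerDifferential k S))
  | 0 => I • OmegaPow k S 0
  | j + 1 =>
      I • OmegaPow k S (j + 1) ⊔
        Submodule.span S
          {x | ∃ θ ∈ I, ∃ ε ∈ OmegaPow k S j, x = dE k S θ * ε}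

/-- `(J·J)^j = Σ_{a+b=j} J^a ∧ J^b`, the degree `j` part of the square of the differential
graded ideal generated by `I`. -/
def JJdeg (S : Type) [CommRing S] [Algebra k S] (I : Ideal S) (j : ℕ) :
    Submodule S (ExteriorAlgebra S (KaehlerDifferential k S)) :=
  ⨆ p : {p : ℕ × ℕ // p.1 + p.2 = j},
    Submodule.span S
      {x | ∃ y ∈ Jdeg k S I p.1.1, ∃ z ∈ Jdeg k S I p.1.2, x = y * z}

/-- `P` is the map `Ω^•_{S/k} → Ω^•_{T/k}` of exterior algebras of differential forms
induced by a ring homomorphism `φ : S → T` (of `k`-algebras): it is a ring homomorphism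
satisfying `P(s·1) = φ(s)·1` on scalars and `P(ds) = d(φ s)` on exact one-forms.  These
two conditions determine `P` uniquely, since the exterior algebra is generated as a ring
by the scalars and the exact one-forms. -/
def IsPullback (S T : Type) [CommRing S] [CommRing T] [Algebra k S] [Algebra k T]
    (φ : S →+* T)
    (P : ExteriorAlgebra S (KaehlerDifferential k S) →+*
      ExteriorAlgebra T (KaehlerDifferential k T)) : Prop :=
  (∀ s : S, P (algebraMap S (ExteriorAlgebra S (KaehlerDifferential k S)) s) =
    algebraMap T (ExteriorAlgebra T (KaehlerDifferential k T)) (φ s)) ∧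
  (∀ s : S, P (dE k S s) = dE k T (φ s))

section Forms

variable {k} {S T : Type} [CommRing S] [CommRing T] [Algebra k S] [Algebra k T]

theorem dE_mem_range (s : S) :
    dE k S s ∈ LinearMap.range (ExteriorAlgebra.ι S : KaehlerDifferential k S →ₗ[S] _) :=
  ⟨_, rfl⟩

theorem dE_mul_mem_OmegaPow (s : S) {j : ℕ} {x : ExteriorAlgebra S (KaehlerDifferential k S)}
    (hx : x ∈ OmegaPow k S j) : dE k S s * x ∈ OmegaPow k S (j + 1) := by
  rw [OmegaPow, pow_succ']
  exact Submodule.mul_mem_mul (dE_mem_range s) hx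

theorem algebraMap_mem_OmegaPow_zero (s : S) :
    algebraMap S (ExteriorAlgebra S (KaehlerDifferential k S)) s ∈ OmegaPow k S 0 := by
  rw [OmegaPow, pow_zero]
  exact Submodule.algebraMap_mem s

theorem dE_sub (a b : S) : dE k S (a - b) = dE k S a - dE k S b := by
  simp [dE]

theorem dE_mul_dE_mul (a b : S) (x : ExteriorAlgebra S (KaehlerDifferential k S)) :
    dE k S a * (dE k S b * x) = -(dE k S b * (dE k S a * x)) := by
  rw [← mul_assoc, ← mul_assoc, ← neg_mul]
  congr 1
  exact eq_neg_of_add_eq_zero_left (ExteriorAlgebra.ι_add_mul_swap _ _)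

/-- Homogeneous forms are generated by scalars under sums, scalar multiples, and left
multiplication by exact one-forms. -/
theorem OmegaPow_induction
    {C : ℕ → ExteriorAlgebra S (KaehlerDifferential k S) → Prop}
    (algebraMap : ∀ s, C 0 (algebraMap S _ s))
    (add : ∀ j x y, C j x → C j y → C j (x + y))
    (smul : ∀ j (s : S) x, x ∈ OmegaPow k S j → C j x → C j (s • x))
    (dE_mul : ∀ j s x, x ∈ OmegaPow k S j → C j x → C (j + 1) (dE k S s * x))
    {j : ℕ} {x : ExteriorAlgebra S (KaehlerDifferential k S)} (hx : x ∈ OmegaPow k S j) :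
    C j x := by
  induction j generalizing x with
  | zero =>
    rw [OmegaPow, pow_zero] at hx
    obtain ⟨s, rfl⟩ := Submodule.mem_one.1 hx
    exact algebraMap s
  | succ j ih =>
    rw [OmegaPow, pow_succ'] at hx
    refine Submodule.mul_induction_on hx ?_ (add _)
    rintro _ ⟨m, rfl⟩ y hy
    have hm : m ∈ Submodule.span S (Set.range (KaehlerDifferential.D k S)) := by
      rw [KaehlerDifferential.span_range_derivation]; trivial
    induction hm using Submodule.span_induction with
    | mem m h =>
      obtain ⟨s, rfl⟩ := h
      exact dE_mul j s y hy (ih hy)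
    | zero =>
      have h := smul _ 0 _ (dE_mul_mem_OmegaPow 0 hy) (dE_mul j 0 y hy (ih hy))
      simpa using h
    | add a b _ _ ha hb =>
      rw [map_add, add_mul]
      exact add _ _ _ ha hb
    | smul s a _ ha =>
      rw [map_smul, smul_mul_assoc]
      refine smul _ _ _ ?_ ha
      rw [OmegaPow, pow_succ']
      exact Submodule.mul_mem_mul ⟨_, rfl⟩ hy

theorem smul_mem_Jdeg {I : Ideal S} {s : S} (hs : s ∈ I) {j : ℕ}
    {x : ExteriorAlgebra S (KaehlerDifferential k S)} (hx : x ∈ OmegaPow k S j) :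
    s • x ∈ Jdeg k S I j := by
  cases j with
  | zero => exact Submodule.smul_mem_smul hs hx
  | succ j => exact Submodule.mem_sup_left (Submodule.smul_mem_smul hs hx)

theorem dE_mul_mem_Jdeg {I : Ideal S} {s : S} (hs : s ∈ I) {j : ℕ}
    {x : ExteriorAlgebra S (KaehlerDifferential k S)} (hx : x ∈ OmegaPow k S j) :
    dE k S s * x ∈ Jdeg k S I (j + 1) :=
  Submodule.mem_sup_right (Submodule.subset_span ⟨s, hs, x, hx, rfl⟩)

theorem Jdeg_induction {I : Ideal S} {C : ℕ → ExteriorAlgebra S (KaehlerDifferential k S) → Prop}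
    (zero : ∀ j, C j 0)
    (add : ∀ j x y, C j x → C j y → C j (x + y))
    (smul : ∀ j (s : S) x, C j x → C j (s • x))
    (smul_mem : ∀ j, ∀ s ∈ I, ∀ x ∈ OmegaPow k S j, C j (s • x))
    (dE_mul : ∀ j, ∀ s ∈ I, ∀ x ∈ OmegaPow k S j, C (j + 1) (dE k S s * x))
    {j : ℕ} {x : ExteriorAlgebra S (KaehlerDifferential k S)} (hx : x ∈ Jdeg k S I j) :
    C j x := by
  cases j with
  | zero => exact Submodule.smul_induction_on hx (smul_mem 0) (add 0)
  | succ j =>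
    obtain ⟨y, hy, z, hz, rfl⟩ := Submodule.mem_sup.1 hx
    refine add _ _ _ (Submodule.smul_induction_on hy (smul_mem _) (add _)) ?_
    refine Submodule.span_induction ?_ (zero _) (fun _ _ _ _ => add _ _ _)
      (fun _ _ _ => smul _ _ _) hz
    rintro _ ⟨s, hs, x, hx, rfl⟩
    exact dE_mul j s hs x hx

theorem dE_mul_Jdeg {I : Ideal S} (s : S) {j : ℕ}
    {x : ExteriorAlgebra S (KaehlerDifferential k S)} (hx : x ∈ Jdeg k S I j) :
    dE k S s * x ∈ Jdeg k S I (j + 1) := by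
  refine Jdeg_induction (C := fun j x => dE k S s * x ∈ Jdeg k S I (j + 1))
    (fun _ => by simp) (fun _ _ _ hx hy => ?_) (fun _ t _ hx => ?_) (fun _ t ht x hx => ?_)
    (fun _ t ht x hx => ?_) hx
  · rw [mul_add]
    exact add_mem hx hy
  · rw [mul_smul_comm]
    exact Submodule.smul_mem _ _ hx
  · rw [mul_smul_comm]
    exact smul_mem_Jdeg ht (dE_mul_mem_OmegaPow s hx)
  · rw [dE_mul_dE_mul]
    exact neg_mem (dE_mul_mem_Jdeg ht (dE_mul_mem_OmegaPow s hx))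

theorem exists_isPullback_algebraMap [Algebra S T] [IsScalarTower k S T] :
    ∃ P, IsPullback k S T (algebraMap S T) P := by
  let f : KaehlerDifferential k S →ₗ[S] ExteriorAlgebra T (KaehlerDifferential k T) :=
    { toFun := fun x => ExteriorAlgebra.ι T (KaehlerDifferential.map k k S T x)
      map_add' := by simp
      map_smul' := fun s x => by
        rw [map_smul, RingHom.id_apply, ← algebraMap_smul T s, map_smul, algebraMap_smul] }
  refine ⟨(ExteriorAlgebra.lift S ⟨f, fun m => ExteriorAlgebra.ι_sq_zero _⟩).toRingHom,
    fun s => ?_, fun s => ?_⟩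
  · exact AlgHom.commutes _ s
  · refine (ExteriorAlgebra.lift_ι_apply S f _ _).trans ?_
    exact congrArg (ExteriorAlgebra.ι T) (KaehlerDifferential.map_D k k S T s)

theorem exists_isPullback (φ : S →ₐ[k] T) : ∃ P, IsPullback k S T (φ : S →+* T) P := by
  let _ : Algebra S T := (φ : S →+* T).toAlgebra
  have : IsScalarTower k S T := IsScalarTower.of_algebraMap_eq fun r => (φ.commutes r).symm
  exact exists_isPullback_algebraMap

namespace IsPullback

variable {φ : S →+* T} {P : ExteriorAlgebra S (KaehlerDifferential k S) →+*
  ExteriorAlgebra T (KaehlerDifferential k T)}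

theorem map_smul (hP : IsPullback k S T φ P) (s : S)
    (x : ExteriorAlgebra S (KaehlerDifferential k S)) : P (s • x) = φ s • P x := by
  rw [Algebra.smul_def, Algebra.smul_def, map_mul, hP.1]

theorem map_mem (hP : IsPullback k S T φ P) {j : ℕ}
    {x : ExteriorAlgebra S (KaehlerDifferential k S)} (hx : x ∈ OmegaPow k S j) :
    P x ∈ OmegaPow k T j := by
  refine OmegaPow_induction (C := fun j x => P x ∈ OmegaPow k T j)
    (fun s => ?_) (fun _ _ _ hx hy => ?_) (fun _ s x _ hx => ?_) (fun _ s x _ hx => ?_) hx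
  · rw [hP.1]
    exact algebraMap_mem_OmegaPow_zero _
  · rw [map_add]
    exact add_mem hx hy
  · rw [hP.map_smul]
    exact Submodule.smul_mem _ _ hx
  · rw [map_mul, hP.2]
    exact dE_mul_mem_OmegaPow _ hx

theorem map_eq_zero (hP : IsPullback k S T φ P) {I : Ideal S} (hI : I ≤ RingHom.ker φ) {j : ℕ}
    {x : ExteriorAlgebra S (KaehlerDifferential k S)} (hx : x ∈ Jdeg k S I j) : P x = 0 := by
  refine Jdeg_induction (C := fun _ x => P x = 0) (fun _ => map_zero P)
    (fun _ _ _ hx hy => by rw [map_add, hx, hy, add_zero])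
    (fun _ s _ hx => by rw [hP.map_smul, hx, smul_zero])
    (fun _ s hs _ _ => ?_) (fun _ s hs _ _ => ?_) hx
  · rw [hP.map_smul, RingHom.mem_ker.1 (hI hs), zero_smul]
  · rw [map_mul, hP.2, RingHom.mem_ker.1 (hI hs)]
    simp [dE]

theorem leftInverse {ψ : T →+* S} {Q : ExteriorAlgebra T (KaehlerDifferential k T) →+*
      ExteriorAlgebra S (KaehlerDifferential k S)}
    (hP : IsPullback k S T φ P) (hQ : IsPullback k T S ψ Q) (h : Function.LeftInverse ψ φ)
    {j : ℕ} {x : ExteriorAlgebra S (KaehlerDifferential k S)} (hx : x ∈ OmegaPow k S j) :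
    Q (P x) = x := by
  refine OmegaPow_induction (C := fun _ x => Q (P x) = x)
    (fun s => ?_) (fun _ _ _ hx hy => ?_) (fun _ s x _ hx => ?_) (fun _ s x _ hx => ?_) hx
  · rw [hP.1, hQ.1, h]
  · rw [map_add, map_add, hx, hy]
  · rw [hP.map_smul, hQ.map_smul, h, hx]
  · rw [map_mul, map_mul, hP.2, hQ.2, h, hx]

theorem sub_mem_Jdeg {ψ : T →+* S} {Q : ExteriorAlgebra T (KaehlerDifferential k T) →+*
      ExteriorAlgebra S (KaehlerDifferential k S)}
    (hP : IsPullback k S T φ P) (hQ : IsPullback k T S ψ Q) (h : Function.LeftInverse ψ φ)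
    {j : ℕ} {x : ExteriorAlgebra T (KaehlerDifferential k T)} (hx : x ∈ OmegaPow k T j) :
    x - P (Q x) ∈ Jdeg k T (RingHom.ker ψ) j := by
  have hker (t : T) : t - φ (ψ t) ∈ RingHom.ker ψ := by
    rw [RingHom.mem_ker, map_sub, h, sub_self]
  refine OmegaPow_induction (C := fun j x => x - P (Q x) ∈ Jdeg k T (RingHom.ker ψ) j)
    (fun t => ?_) (fun _ x y hx hy => ?_) (fun _ t x hx hC => ?_) (fun _ t x hx hC => ?_) hx
  · rw [hQ.1, hP.1, ← map_sub, Algebra.algebraMap_eq_smul_one]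
    exact smul_mem_Jdeg (hker t) (by simpa using algebraMap_mem_OmegaPow_zero (k := k) (1 : T))
  · rw [map_add, map_add, add_sub_add_comm]
    exact add_mem hx hy
  · have : t • x - P (Q (t • x)) = (t - φ (ψ t)) • x + φ (ψ t) • (x - P (Q x)) := by
      rw [hQ.map_smul, hP.map_smul, sub_smul, smul_sub]
      abel
    rw [this]
    exact add_mem (smul_mem_Jdeg (hker t) hx) (Submodule.smul_mem _ _ hC)
  · have : dE k T t * x - P (Q (dE k T t * x)) =
        dE k T (t - φ (ψ t)) * x + dE k T (φ (ψ t)) * (x - P (Q x)) := by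
      rw [map_mul, map_mul, hQ.2, hP.2, dE_sub, sub_mul, mul_sub]
      abel
    rw [this]
    exact add_mem (dE_mul_mem_Jdeg (hker t) hx) (dE_mul_Jdeg _ hC)

end IsPullback

end Forms

/-!
STATEMENT 3.
Let `k` be a field, `A` a smooth `k`-algebra (of finite presentation and formally smooth),
and `j ≥ 1`.  Then `Ω^j_{A⊗A}` decomposes as an internal direct sum
`Ω^j_{A⊗A} = p₁^*(Ω^j_A) ⊕ J^j`: every `ω ∈ Ω^j_{A⊗A}` can be written uniquely as
`ω = p₁^*(δ) + η` with `δ ∈ Ω^j_A` and `η ∈ J^j`.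

Here `Ω^j` is the degree-`j` part of the exterior algebra of Kähler differentials
(`OmegaPow`), `J^j` is the degree-`j` part of the differential graded ideal generated by
the diagonal ideal `I` (`Jdeg`), and `p₁^*` is the map induced on forms by `a ↦ a⊗1`,
characterized by `IsPullback`.
-/
theorem stmt3 (A : Type) [CommRing A] [Algebra k A]
    [Algebra.FormallySmooth k A] [Algebra.FinitePresentation k A]
    (j : ℕ) (hj : 1 ≤ j)
    (p1 : ExteriorAlgebra A (KaehlerDifferential k A) →+*
      ExteriorAlgebra (A ⊗[k] A) (KaehlerDifferential k (A ⊗[k] A)))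
    (hp1 : IsPullback k A (A ⊗[k] A)
      (Algebra.TensorProduct.includeLeftRingHom : A →+* A ⊗[k] A) p1)
    (ω : ExteriorAlgebra (A ⊗[k] A) (KaehlerDifferential k (A ⊗[k] A)))
    (hω : ω ∈ OmegaPow k (A ⊗[k] A) j) :
    ∃ (δ : ExteriorAlgebra A (KaehlerDifferential k A))
      (η : ExteriorAlgebra (A ⊗[k] A) (KaehlerDifferential k (A ⊗[k] A))),
      (δ ∈ OmegaPow k A j ∧
        η ∈ Jdeg k (A ⊗[k] A) (KaehlerDifferential.ideal k A) j ∧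
        ω = p1 δ + η) ∧
      ∀ (δ' : ExteriorAlgebra A (KaehlerDifferential k A))
        (η' : ExteriorAlgebra (A ⊗[k] A) (KaehlerDifferential k (A ⊗[k] A))),
        δ' ∈ OmegaPow k A j →
        η' ∈ Jdeg k (A ⊗[k] A) (KaehlerDifferential.ideal k A) j →
        ω = p1 δ' + η' → δ' = δ ∧ η' = η := by
  obtain ⟨m, hm⟩ := exists_isPullback (Algebra.TensorProduct.lmul' k (S := A))
  have hinv : Function.LeftInverse
      ((Algebra.TensorProduct.lmul' k (S := A) : A ⊗[k] A →ₐ[k] A) : A ⊗[k] A →+* A)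
      (Algebra.TensorProduct.includeLeftRingHom : A →+* A ⊗[k] A) := fun a => by simp
  refine ⟨m ω, ω - p1 (m ω), ⟨hm.map_mem hω, hp1.sub_mem_Jdeg hm hinv hω, by abel⟩, ?_⟩
  intro δ' η' hδ hη h
  have hmω : m ω = δ' := by
    rw [h, map_add, hp1.leftInverse hm hinv hδ, hm.map_eq_zero le_rfl hη, add_zero]
  exact ⟨hmω.symm, by rw [hmω, h, add_sub_cancel_left]⟩

end
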